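/- arXiv:1604.08677 — 2 statements merged into one kernel-verified Lean document; each statement's English description precedes it below -/
import Mathlib

section
/- Let θ_0 = 1, θ_1, …, θ_q be real numbers and T ≥ q a positive integer. Then Σ_T = Θ_T Θ_Tᵀ + Θ_{*;T−q} Θ_{*;T−q}ᵀ; equivalently, with λ = Θ_T⁻¹ Θ_{*;T−q}, Σ_T = Θ_T (I_T + λλᵀ) Θ_Tᵀ and hence Σ_T⁻¹ = Θ_T⁻¹ᵀ K Θ_T⁻¹ where K = (I_T + λλᵀ)⁻¹. -/
open Matrix

section Autocovariance

variable {θ : ℕ → ℝ} {q : ℕ}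

/-- The sum defining the autocovariance of a finitely supported sequence may be truncated at any
point past the support. -/
theorem autocovariance_eq_sum_range (hsupp : ∀ l, q < l → θ l = 0) {d N : ℕ} (hN : q < N + d) :
    (if d ≤ q then ∑ j ∈ Finset.range (q - d + 1), θ j * θ (j + d) else 0) =
      ∑ j ∈ Finset.range N, θ j * θ (j + d) := by
  split_ifs with h
  · refine Finset.sum_subset (fun x hx => ?_) (fun x _ hx => ?_)
    · simp only [Finset.mem_range] at *
      omega
    · simp only [Finset.mem_range] at hx
      rw [hsupp (x + d) (by omega), mul_zero]
  · exact (Finset.sum_eq_zero fun x _ => by rw [hsupp (x + d) (by omega), mul_zero]).symm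

theorem sum_lowerToeplitz_mul {T i j : ℕ} (hji : j ≤ i) (hj : j < T) :
    ∑ k : Fin T, (if (k : ℕ) ≤ i then θ (i - k) else 0) * (if (k : ℕ) ≤ j then θ (j - k) else 0) =
      ∑ l ∈ Finset.range (j + 1), θ l * θ (l + (i - j)) := by
  rw [Fin.sum_univ_eq_sum_range
    (fun k => (if k ≤ i then θ (i - k) else 0) * (if k ≤ j then θ (j - k) else 0)) T,
    ← Finset.sum_range_reflect (fun l => θ l * θ (l + (i - j)))]
  symm
  apply Finset.sum_subset_zero_on_sdiff
  · intro x hx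
    simp only [Finset.mem_range] at *
    omega
  · intro x hx
    simp only [Finset.mem_sdiff, Finset.mem_range] at hx
    rw [if_neg (show ¬ x ≤ j by omega), mul_zero]
  · intro x hx
    rw [Finset.mem_range] at hx
    rw [if_pos (by omega), if_pos (by omega), mul_comm]
    congr 2
    omega

theorem sum_upperToeplitz_mul {i j : ℕ} (hji : j ≤ i) :
    ∑ k : Fin q, (if i ≤ (k : ℕ) then θ (q - (k - i)) else 0) *
        (if j ≤ (k : ℕ) then θ (q - (k - j)) else 0) =
      ∑ l ∈ Finset.range (q - i), θ (j + 1 + l) * θ (j + 1 + l + (i - j)) := by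
  rw [Fin.sum_univ_eq_sum_range (fun k => (if i ≤ k then θ (q - (k - i)) else 0) *
    (if j ≤ k then θ (q - (k - j)) else 0)) q, ← Finset.sum_range_reflect]
  symm
  apply Finset.sum_subset_zero_on_sdiff
  · intro x hx
    simp only [Finset.mem_range] at *
    omega
  · intro x hx
    simp only [Finset.mem_sdiff, Finset.mem_range] at hx
    rw [if_neg (show ¬ i ≤ q - 1 - x by omega), zero_mul]
  · intro x hx
    rw [Finset.mem_range] at hx
    rw [if_pos (by omega), if_pos (by omega), mul_comm]
    congr 2 <;> omega

theorem autocovariance_eq_add (hsupp : ∀ l, q < l → θ l = 0) {T i j : ℕ} (hji : j ≤ i)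
    (hj : j < T) :
    (if i - j ≤ q then ∑ l ∈ Finset.range (q - (i - j) + 1), θ l * θ (l + (i - j)) else 0) =
      ∑ k : Fin T, (if (k : ℕ) ≤ i then θ (i - k) else 0) *
        (if (k : ℕ) ≤ j then θ (j - k) else 0) +
      ∑ k : Fin q, (if i ≤ (k : ℕ) then θ (q - (k - i)) else 0) *
        (if j ≤ (k : ℕ) then θ (q - (k - j)) else 0) := by
  rw [sum_lowerToeplitz_mul hji hj, sum_upperToeplitz_mul hji,
    autocovariance_eq_sum_range hsupp (N := j + 1 + (q - i)) (by omega), Finset.sum_range_add]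

end Autocovariance

/-- For `θ_0 = 1, θ_1, …, θ_q` and `T ≥ q`:
`Σ_T = Θ_T Θ_Tᵀ + Θ_{*;T−q} Θ_{*;T−q}ᵀ`; with `λ = Θ_T⁻¹ Θ_{*;T−q}`,
`Σ_T = Θ_T (I_T + λλᵀ) Θ_Tᵀ` and `Σ_T⁻¹ = (Θ_T⁻¹)ᵀ K Θ_T⁻¹` where `K = (I_T + λλᵀ)⁻¹`. -/
theorem stmt_7 (q T : ℕ) (hq : 0 < q) (hqT : q ≤ T)
    (θ : ℕ → ℝ) (h0 : θ 0 = 1) (hsupp : ∀ l, q < l → θ l = 0) :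
    let Θ : Matrix (Fin T) (Fin T) ℝ :=
      Matrix.of fun i j => if (j : ℕ) ≤ (i : ℕ) then θ ((i : ℕ) - (j : ℕ)) else 0
    let Θstar : Matrix (Fin T) (Fin q) ℝ :=
      Matrix.of fun i j =>
        if (i : ℕ) ≤ (j : ℕ) then θ (q - ((j : ℕ) - (i : ℕ))) else 0
    let γ : ℕ → ℝ := fun l =>
      if l ≤ q then ∑ j ∈ Finset.range (q - l + 1), θ j * θ (j + l) else 0
    let Sg : Matrix (Fin T) (Fin T) ℝ :=
      Matrix.of fun i j => γ (((i : ℕ) : ℤ) - ((j : ℕ) : ℤ)).natAbs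
    let lam : Matrix (Fin T) (Fin q) ℝ := Θ⁻¹ * Θstar
    let K : Matrix (Fin T) (Fin T) ℝ := (1 + lam * lamᵀ)⁻¹
    Sg = Θ * Θᵀ + Θstar * Θstarᵀ ∧
    Sg = Θ * (1 + lam * lamᵀ) * Θᵀ ∧
    Sg⁻¹ = (Θ⁻¹)ᵀ * K * Θ⁻¹ := by
  intro Θ Θstar γ Sg lam K
  have hdet : IsUnit Θ.det := by
    rw [det_of_isLowerTriangular Θ fun i j hij => if_neg (not_le.mpr hij)]
    simp [Θ, h0]
  have hsum : Sg = Θ * Θᵀ + Θstar * Θstarᵀ := by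
    ext i j
    simp only [Sg, Θ, Θstar, γ, Matrix.add_apply, mul_apply, transpose_apply, of_apply]
    rcases le_total (j : ℕ) i with h | h
    · rw [show (((i : ℕ) : ℤ) - ((j : ℕ) : ℤ)).natAbs = (i : ℕ) - j by omega]
      exact autocovariance_eq_add hsupp h j.isLt
    · rw [show (((i : ℕ) : ℤ) - ((j : ℕ) : ℤ)).natAbs = (j : ℕ) - i by omega,
        autocovariance_eq_add hsupp h i.isLt]
      simp only [mul_comm]
  have hlam : Θ * lam = Θstar := mul_nonsing_inv_cancel_left Θ Θstar hdet
  have hfactor : Sg = Θ * (1 + lam * lamᵀ) * Θᵀ := by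
    rw [hsum, ← hlam, transpose_mul]
    simp only [Matrix.mul_add, Matrix.add_mul, Matrix.mul_one, Matrix.mul_assoc]
  refine ⟨hsum, hfactor, ?_⟩
  rw [hfactor, Matrix.mul_inv_rev, Matrix.mul_inv_rev, ← transpose_nonsing_inv, ← Matrix.mul_assoc]
end

section
/- (Root inversion scaling of the concentrated covariance matrix.) Let q be a positive integer, λ_1, …, λ_q nonzero complex numbers, and S ⊆ {1, …, q}. Write θ(z) = ∏_{i=1}^q (1 − λ_i z) = Σ_{l=0}^q θ_l z^l and θ_IR(z) = ∏_{i∉S}(1 − λ_i z)·∏_{i∈S}(1 − λ_i⁻¹ z) = Σ_{l=0}^q θ_{IR,l} z^l. For a coefficient vector c = (c_0, …, c_q) define γ_l(c) = Σ_{j=0}^{q−l} c_j c_{j+l} for 0 ≤ l ≤ q and 0 for l > q, and let Σ_T(c) be the T×T symmetric Toeplitz matrix with (i,j) entry γ_{|i−j|}(c). Then for every positive integer T, Σ_T(θ_IR) = (∏_{i∈S} λ_i)⁻² Σ_T(θ), and consequently det(Σ_T(θ_IR)) = (∏_{i∈S} λ_i)⁻²ᵀ det(Σ_T(θ)). -/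
open Matrix Polynomial

lemma natDegree_prod_one_sub_C_mul_X_le {R ι : Type*} [CommRing R] (s : Finset ι) (a : ι → R) :
    (∏ i ∈ s, (1 - C (a i) * X)).natDegree ≤ s.card := by
  refine (natDegree_prod_le s _).trans ((Finset.sum_le_card_nsmul s _ 1 fun i _ => ?_).trans ?_)
  · show (1 - C (a i) * X).natDegree ≤ 1
    compute_degree
  · simp

lemma reflect_prod_one_sub_C_mul_X {R ι : Type*} [CommRing R] (s : Finset ι) (a : ι → R) :
    reflect s.card (∏ i ∈ s, (1 - C (a i) * X)) = ∏ i ∈ s, (X - C (a i)) := by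
  classical
  induction s using Finset.induction_on with
  | empty => simp [reflect_one]
  | insert i s hi ih =>
    rw [Finset.prod_insert hi, Finset.prod_insert hi, Finset.card_insert_of_notMem hi, add_comm,
      reflect_mul _ _ (by compute_degree) (natDegree_prod_one_sub_C_mul_X_le s a), ih]
    congr 1
    rw [reflect_sub, reflect_one, ← pow_one X, reflect_C_mul_X_pow]
    simp [revAt_le]

/-- The lag-`l` autocovariance of the coefficients of `p` is a coefficient of
`p * reflect q p`. -/
lemma sum_coeff_mul_coeff_add_eq_coeff_mul_reflect {R : Type*} [CommRing R] (p : R[X])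
    {q l : ℕ} (h : l ≤ q) :
    ∑ j ∈ Finset.range (q - l + 1), p.coeff j * p.coeff (j + l) =
      (p * reflect q p).coeff (q - l) := by
  rw [coeff_mul, Finset.Nat.sum_antidiagonal_eq_sum_range_succ_mk]
  refine Finset.sum_congr rfl fun j hj => ?_
  have hj' := Finset.mem_range.mp hj
  rw [coeff_reflect, revAt_le (by omega)]
  congr 2
  omega

lemma one_sub_inv_mul_X_mul_X_sub_inv {K : Type*} [Field K] {a : K} (ha : a ≠ 0) :
    (1 - C a⁻¹ * X) * (X - C a⁻¹) = C (a ^ 2)⁻¹ * ((1 - C a * X) * (X - C a)) := by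
  have h : C a⁻¹ * C a = (1 : K[X]) := by rw [← C_mul, inv_mul_cancel₀ ha, C_1]
  rw [← inv_pow, C_pow]
  linear_combination (C a⁻¹ + C a⁻¹ * X ^ 2 - X * (C a⁻¹ * C a + 1)) * h

/-- Root inversion scaling of the concentrated covariance matrix: with
`θ(z) = ∏ᵢ(1 − λᵢ z)` and `θ_IR` obtained by inverting the roots indexed by `S`,
`Σ_T(θ_IR) = (∏_{i∈S} λᵢ)⁻² Σ_T(θ)` and
`det Σ_T(θ_IR) = (∏_{i∈S} λᵢ)⁻²ᵀ det Σ_T(θ)` for every `T > 0`. -/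
theorem stmt_19 (q : ℕ) (hq : 0 < q) (lam : Fin q → ℂ) (hlam : ∀ i, lam i ≠ 0)
    (S : Finset (Fin q)) :
    let P : Polynomial ℂ := ∏ i, (1 - C (lam i) * X)
    let PIR : Polynomial ℂ :=
      (∏ i ∈ Sᶜ, (1 - C (lam i) * X)) * ∏ i ∈ S, (1 - C (lam i)⁻¹ * X)
    let γ : (ℕ → ℂ) → ℕ → ℂ := fun c l =>
      if l ≤ q then ∑ j ∈ Finset.range (q - l + 1), c j * c (j + l) else 0
    let Sg : (T : ℕ) → (ℕ → ℂ) → Matrix (Fin T) (Fin T) ℂ := fun T c =>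
      Matrix.of fun i j => γ c (((i : ℕ) : ℤ) - ((j : ℕ) : ℤ)).natAbs
    ∀ T : ℕ, 0 < T →
      Sg T PIR.coeff = ((∏ i ∈ S, lam i) ^ 2)⁻¹ • Sg T P.coeff ∧
      (Sg T PIR.coeff).det = ((∏ i ∈ S, lam i) ^ (2 * T))⁻¹ * (Sg T P.coeff).det := by
  intro P PIR γ Sg T _
  have hcard : q = Sᶜ.card + S.card := by
    rw [Finset.card_compl_add_card, Fintype.card_fin]
  have hP : P = (∏ i ∈ Sᶜ, (1 - C (lam i) * X)) * ∏ i ∈ S, (1 - C (lam i) * X) :=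
    (Finset.prod_compl_mul_prod S _).symm
  have key : PIR * reflect q PIR = C ((∏ i ∈ S, lam i) ^ 2)⁻¹ * (P * reflect q P) := by
    have hS : (∏ i ∈ S, (1 - C (lam i)⁻¹ * X)) * ∏ i ∈ S, (X - C (lam i)⁻¹) =
        C ((∏ i ∈ S, lam i) ^ 2)⁻¹ *
          ((∏ i ∈ S, (1 - C (lam i) * X)) * ∏ i ∈ S, (X - C (lam i))) := by
      rw [← Finset.prod_pow, ← Finset.prod_inv_distrib, map_prod, ← Finset.prod_mul_distrib,
        ← Finset.prod_mul_distrib, ← Finset.prod_mul_distrib]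
      exact Finset.prod_congr rfl fun i _ => one_sub_inv_mul_X_mul_X_sub_inv (hlam i)
    have hR (a : Fin q → ℂ) :
        reflect q ((∏ i ∈ Sᶜ, (1 - C (lam i) * X)) * ∏ i ∈ S, (1 - C (a i) * X)) =
          (∏ i ∈ Sᶜ, (X - C (lam i))) * ∏ i ∈ S, (X - C (a i)) := by
      rw [← reflect_prod_one_sub_C_mul_X, ← reflect_prod_one_sub_C_mul_X, ← reflect_mul _ _
        (natDegree_prod_one_sub_C_mul_X_le _ _) (natDegree_prod_one_sub_C_mul_X_le _ _), ← hcard]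
    rw [hP, hR lam, hR fun i => (lam i)⁻¹]
    linear_combination
      ((∏ i ∈ Sᶜ, (1 - C (lam i) * X)) * ∏ i ∈ Sᶜ, (X - C (lam i))) * hS
  have hγ (l : ℕ) : γ PIR.coeff l = ((∏ i ∈ S, lam i) ^ 2)⁻¹ * γ P.coeff l := by
    by_cases hl : l ≤ q
    · simp only [γ, if_pos hl, sum_coeff_mul_coeff_add_eq_coeff_mul_reflect _ hl, key,
        coeff_C_mul]
    · simp only [γ, if_neg hl, mul_zero]
  have hSg : Sg T PIR.coeff = ((∏ i ∈ S, lam i) ^ 2)⁻¹ • Sg T P.coeff := by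
    ext i j
    exact hγ _
  refine ⟨hSg, ?_⟩
  rw [hSg, det_smul, Fintype.card_fin, inv_pow, ← pow_mul]
end
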